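/- Fix an odd prime p and let M_s = M(λ(2s;(x_{(2s,0)}, x_{(s,0)}))) denote the p^{(0)}-Fibonacci numbers (k = 0, r = s). Then for every real number x with |x| < 1/p, the series ∑_{s=2}^∞ M_s x^{s−2} converges and equals ((p−1)/2)·( (2p − 2px)/(1 − px)² − 1/(1 − px) ). -/

import Mathlib

open Finset

namespace Bratteli

/-- `x_{(a,k)} = p^k (a·p - (a+1))` (the labels of the vertices of the p-Bratteli diagram). -/
def xv (p a k : ℕ) : ℕ := p ^ k * (a * p - (a + 1))

/-- `j^k_t = t · ∑_{i<k} p^i`. -/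
def jkt (p k t : ℕ) : ℕ := t * ∑ i ∈ range k, p ^ i

/-- base-`p` digits of `N`: a path of shape `λ(2r;(x_{(2s,k)},x_{(s,k)}+l))` is encoded by the
digit tuple `(t_0, …, t_{r-1})` of a number `N < p^r`. -/
def tDig (p N : ℕ) : ℕ → ℕ := fun i => N / p ^ i % p

/-- `α_j = ∑_{i=j}^{k+j-2} p^{i-j} t_i`. -/
def alphaF (p k : ℕ) (t : ℕ → ℕ) (j : ℕ) : ℕ := ∑ d ∈ range (k - 1), p ^ d * t (j + d)

/-- `i_j = ∑_{i=r-j}^{r-1} p^{i-(r-j)} t_i`. -/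
def iIdx (p r : ℕ) (t : ℕ → ℕ) (j : ℕ) : ℕ := ∑ d ∈ range j, p ^ d * t (r - j + d)

/-- vertical part `n_i` of the `i`-th block of the path encoded by `t`. -/
def nB (p k r : ℕ) (t : ℕ → ℕ) (i : ℕ) : ℕ :=
  if i % 2 = 1 then
    -- odd blocks `i = 2j+1`
    if i / 2 < k then 0 else p ^ k * (p - 1 - t (k + r - i / 2 - 1))
  else
    -- even blocks `i = 2j`
    if i / 2 ≤ k then (p - 1) * iIdx p r t (i / 2) + t (r - i / 2 - 1)
    else if k = 0 then t (r - i / 2 - 1)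
    else (p - 1) * (alphaF p k t (r - i / 2) + p ^ (k - 1) * t (k + r - i / 2 - 1))
      + t (r - i / 2 - 1)

/-- horizontal part `m_i` of the `i`-th block of the path encoded by `t`. -/
def mB (p k r : ℕ) (t : ℕ → ℕ) (i : ℕ) : ℕ :=
  if i % 2 = 1 then
    -- odd blocks `i = 2j+1`
    if i / 2 < k then 0 else p ^ k * t (k + r - i / 2 - 1)
  else
    -- even blocks `i = 2j`
    if i / 2 ≤ k then p ^ (k - 1) * (p - 1) ^ 2 - nB p k r t i
    else if k = 0 then p - 1 - t (r - i / 2 - 1)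
    else p ^ k * (p - 1) - nB p k r t (i - 1)

/-- The path encoded by `t` has a descent at block `i`: at block `2k` exactly when
`t_{r-1} < (p-1)/2` (convention (c1)), and at a block `2k+2 ≤ i ≤ 2r-2` exactly when
`m_i > m_{i+1}`; there is never a descent at block `2k+1` or below block `2k`. -/
def HasDescent (p k r : ℕ) (t : ℕ → ℕ) (i : ℕ) : Prop :=
  (i = 2 * k ∧ t (r - 1) < (p - 1) / 2) ∨
    (2 * k + 2 ≤ i ∧ i ≤ 2 * r - 2 ∧ mB p k r t (i + 1) < mB p k r t i)

instance (p k r : ℕ) (t : ℕ → ℕ) : DecidablePred (HasDescent p k r t) := fun i => by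
  unfold HasDescent; infer_instance

/-- `des(P)`: the number of descents of the path encoded by `t`. -/
def desNum (p k r : ℕ) (t : ℕ → ℕ) : ℕ :=
  ((range (2 * r - 1)).filter (HasDescent p k r t)).card

/-- `inv(P)`: the number of inversions of the path encoded by `t`; pairs `(i,j)` with
`2k+2 ≤ i < j ≤ 2r-1`, `m_i + n_i = m_j + n_j`, `m_i > m_j`, `n_i < n_j`, plus `1` exactly
when `t_{r-1} < (p-1)/2` (convention (c1) at block `2k`). -/
def invNum (p k r : ℕ) (t : ℕ → ℕ) : ℕ :=
  ((range (2 * r) ×ˢ range (2 * r)).filter fun q : ℕ × ℕ =>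
      2 * k + 2 ≤ q.1 ∧ q.1 < q.2 ∧
        mB p k r t q.1 + nB p k r t q.1 = mB p k r t q.2 + nB p k r t q.2 ∧
        mB p k r t q.2 < mB p k r t q.1 ∧ nB p k r t q.1 < nB p k r t q.2).card +
    if t (r - 1) < (p - 1) / 2 then 1 else 0

/-- `t` encodes a path of shape `λ(2r;(x_{(2s,k)},x_{(s,k)}+l))`. -/
def IsPath (p k r l : ℕ) (t : ℕ → ℕ) : Prop :=
  (∀ i, i ≤ r - 2 → t i ≤ p - 1) ∧ t (r - 1) ≤ p - 2 ∧ l = ∑ i ∈ range k, p ^ i * t i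

/-- the finite set of all paths of shape `λ(2r;(x_{(2s,k)},x_{(s,k)}+l))`, encoded as the
numbers `N < p^r` whose base-`p` digits give the tuples `(t_0,…,t_{r-1})`. -/
def pathFinset (p k r l : ℕ) : Finset ℕ :=
  (range (p ^ r)).filter fun N =>
    tDig p N (r - 1) ≤ p - 2 ∧ l = ∑ i ∈ range k, p ^ i * tDig p N i

/-- the `p^{(k)}`-Fibonacci number `𝓜(λ(2r;(x_{(2s,k)},x_{(s,k)}+l)))`:
the total number of descents over all paths of this shape. -/
def Mnum (p k r l : ℕ) : ℕ := ∑ N ∈ pathFinset p k r l, desNum p k r (tDig p N)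

end Bratteli

open Bratteli
/-- Prepending a digit to a path adds the two potential descents involving that digit. -/
lemma desNum_succ (p s : ℕ) (hs : 1 ≤ s) (t : ℕ → ℕ) :
    desNum p 0 (s + 1) t = desNum p 0 s (fun i => t (i + 1)) +
      (if 2 ≤ s ∧ p - 1 - t 0 < t 1 then 1 else 0) +
      (if t 0 < p - 1 - t 0 then 1 else 0) := by
  obtain ⟨m, rfl⟩ := Nat.exists_eq_add_of_le hs
  have hm (i : ℕ) (hi : i ≤ 2 * m + 1) (h0 : 1 ≤ i) :
      mB p 0 (1 + m + 1) t i = mB p 0 (1 + m) (fun i => t (i + 1)) i := by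
    have e1 : 1 + m + 1 - i / 2 - 1 = 1 + m - i / 2 - 1 + 1 := by omega
    have e2 : i % 2 ≠ 1 → ¬ i / 2 ≤ 0 := by omega
    unfold mB
    split_ifs with h1 h2 h2
    · rfl
    · simp [e1]
    · exact absurd h2 (e2 h1)
    · rw [e1]
    · contradiction
  unfold desNum
  rw [card_filter, card_filter,
    show 2 * (1 + m + 1) - 1 = 2 * (1 + m) - 1 + 1 + 1 by omega, sum_range_succ, sum_range_succ]
  congr 1
  · congr 1
    · refine sum_congr rfl fun i hi => if_congr ?_ rfl rfl
      rw [mem_range] at hi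
      unfold HasDescent
      refine or_congr ?_ ?_
      · rw [show 1 + m + 1 - 1 = 1 + m - 1 + 1 by omega]
      · constructor
        · rintro ⟨h1, h2, h3⟩
          rw [hm _ (by omega) (by omega), hm _ (by omega) (by omega)] at h3
          exact ⟨h1, by omega, h3⟩
        · rintro ⟨h1, h2, h3⟩
          rw [← hm _ (by omega) (by omega), ← hm _ (by omega) (by omega)] at h3
          exact ⟨h1, by omega, h3⟩
    · refine if_congr ?_ rfl rfl
      have a1 : mB p 0 (1 + m + 1) t (2 * (1 + m) - 1) = t 1 := by
        simp [mB, show (2 * (1 + m) - 1) % 2 = 1 by omega,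
          show 1 + m + 1 - (2 * (1 + m) - 1) / 2 - 1 = 1 by omega]
      have a2 : mB p 0 (1 + m + 1) t (2 * (1 + m) - 1 + 1) = p - 1 - t 0 := by
        simp [mB, show (2 * (1 + m) - 1 + 1) % 2 = 0 by omega,
          show ¬ (2 * (1 + m) - 1 + 1 < 2) by omega,
          show 1 + m + 1 - (2 * (1 + m) - 1 + 1) / 2 - 1 = 0 by omega]
      unfold HasDescent
      rw [a1, a2]
      constructor
      · rintro (h | h) <;> omega
      · intro h
        right
        omega
  · refine if_congr ?_ rfl rfl
    have a1 : mB p 0 (1 + m + 1) t (2 * (1 + m) - 1 + 1) = p - 1 - t 0 := by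
      simp [mB, show (2 * (1 + m) - 1 + 1) % 2 = 0 by omega,
        show ¬ (2 * (1 + m) - 1 + 1 < 2) by omega,
        show 1 + m + 1 - (2 * (1 + m) - 1 + 1) / 2 - 1 = 0 by omega]
    have a2 : mB p 0 (1 + m + 1) t (2 * (1 + m) - 1 + 1 + 1) = t 0 := by
      simp [mB, show (2 * (1 + m) - 1 + 1 + 1) % 2 = 1 by omega,
        show 1 + m + 1 - (2 * (1 + m) - 1 + 1 + 1) / 2 - 1 = 0 by omega]
    unfold HasDescent
    rw [a1, a2]
    constructor
    · rintro (h | h) <;> omega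
    · intro h
      right
      omega

lemma sum_range_mul_eq (f : ℕ → ℕ) (a p : ℕ) :
    ∑ N ∈ range (a * p), f N = ∑ N ∈ range a, ∑ d ∈ range p, f (p * N + d) := by
  induction a with
  | zero => simp
  | succ a ih =>
    rw [sum_range_succ, ← ih, Nat.succ_mul, sum_range_add]
    simp [mul_comm]

lemma sum_range_ite_lt {u n : ℕ} (h : u ≤ n) :
    ∑ j ∈ range n, (if j < u then 1 else 0) = u := by
  rw [← card_filter]
  convert card_range u using 2
  ext j
  simp only [mem_filter, mem_range]
  omega

lemma tDig_mul_add_succ {p d : ℕ} (hd : d < p) (N i : ℕ) :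
    tDig p (p * N + d) (i + 1) = tDig p N i := by
  unfold tDig
  rw [pow_succ', ← Nat.div_div_eq_div_mul, Nat.mul_add_div (by omega), Nat.div_eq_of_lt hd,
    add_zero]

lemma tDig_mul_add_zero {p d : ℕ} (hd : d < p) (N : ℕ) : tDig p (p * N + d) 0 = d := by
  simp [tDig, Nat.mod_eq_of_lt hd]

lemma pathFinset_zero {p : ℕ} (hp : 2 ≤ p) (m : ℕ) :
    pathFinset p 0 (m + 1) 0 = range ((p - 1) * p ^ m) := by
  have hpos : 0 < p ^ m := by positivity
  ext N
  simp only [pathFinset, tDig, mem_filter, mem_range, range_zero, sum_empty, and_true,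
    Nat.add_sub_cancel]
  rw [pow_succ', ← Nat.div_lt_iff_lt_mul hpos, ← Nat.div_lt_iff_lt_mul hpos]
  constructor
  · rintro ⟨h1, h2⟩
    rw [Nat.mod_eq_of_lt h1] at h2
    omega
  · intro h
    rw [Nat.mod_eq_of_lt (by omega)]
    omega

lemma sum_range_mod (p a : ℕ) :
    ∑ N ∈ range (a * p), N % p = a * ∑ d ∈ range p, d := by
  rw [sum_range_mul_eq, sum_congr rfl fun N _ => sum_congr rfl fun d hd => by
    rw [Nat.mul_add_mod, Nat.mod_eq_of_lt (mem_range.1 hd)]]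
  simp

lemma Mnum_succ (h m : ℕ) (hh : 1 ≤ h) :
    Mnum (2 * h + 1) 0 (m + 2) 0 = (2 * h + 1) * Mnum (2 * h + 1) 0 (m + 1) 0 +
      (if 1 ≤ m then ∑ N ∈ range (2 * h * (2 * h + 1) ^ m), N % (2 * h + 1) else 0) +
      2 * h * (2 * h + 1) ^ m * h := by
  have hflip (u : ℕ) (hu : u < 2 * h + 1) :
      ∑ d ∈ range (2 * h + 1), (if 1 ≤ m ∧ 2 * h - d < u then 1 else 0) =
        if 1 ≤ m then u else 0 := by
    split_ifs with hm
    · rw [← sum_range_reflect]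
      refine Eq.trans (sum_congr rfl fun j hj => if_congr ?_ rfl rfl) (sum_range_ite_lt hu.le)
      rw [mem_range] at hj
      omega
    · simp [hm]
  have hlow : ∑ d ∈ range (2 * h + 1), (if d < 2 * h - d then 1 else 0) = h := by
    refine Eq.trans (sum_congr rfl fun j _ => if_congr ?_ rfl rfl)
      (sum_range_ite_lt (by omega : h ≤ 2 * h + 1))
    omega
  have hinner (N : ℕ) : ∑ d ∈ range (2 * h + 1),
      desNum (2 * h + 1) 0 (m + 2) (tDig (2 * h + 1) ((2 * h + 1) * N + d)) =
      (2 * h + 1) * desNum (2 * h + 1) 0 (m + 1) (tDig (2 * h + 1) N) +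
        (if 1 ≤ m then N % (2 * h + 1) else 0) + h := by
    have hconst (c : ℕ) : (2 * h + 1) * c = ∑ _d ∈ range (2 * h + 1), c := by simp
    conv_rhs => rw [← hflip _ (Nat.mod_lt N (by omega)), hconst]
    refine Eq.trans ?_ (congrArg _ hlow)
    rw [← sum_add_distrib, ← sum_add_distrib]
    refine sum_congr rfl fun d hd => ?_
    rw [mem_range] at hd
    rw [desNum_succ _ (m + 1) (by omega), tDig_mul_add_zero hd, tDig_mul_add_succ hd]
    have h0 : tDig (2 * h + 1) N 0 = N % (2 * h + 1) := by simp [tDig]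
    simp [tDig_mul_add_succ hd, h0]
  unfold Mnum
  rw [pathFinset_zero (by omega), pathFinset_zero (by omega), pow_succ, ← mul_assoc,
    sum_range_mul_eq, sum_congr rfl fun N _ => hinner N, sum_add_distrib, sum_add_distrib,
    ← mul_sum]
  simp only [Nat.add_sub_cancel, sum_const, card_range, smul_eq_mul]
  congr 2
  split_ifs <;> simp

lemma Mnum_one (h : ℕ) (hh : 1 ≤ h) : Mnum (2 * h + 1) 0 1 0 = h := by
  unfold Mnum
  rw [pathFinset_zero (by omega)]
  refine Eq.trans (sum_congr rfl fun N hN => ?_) (sum_range_ite_lt (by simp; omega))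
  simp only [pow_zero, mul_one, Nat.add_sub_cancel, mem_range] at hN
  unfold desNum
  rw [card_filter]
  simp [-sum_boole, HasDescent, tDig, Nat.mod_eq_of_lt (show N < 2 * h + 1 by omega)]

lemma Mnum_eq (h n : ℕ) (hh : 1 ≤ h) :
    Mnum (2 * h + 1) 0 (n + 2) 0 =
      h * (2 * h + 1) ^ n * (2 * h * (2 * n + 1) + (2 * h + 1)) := by
  induction n with
  | zero =>
    rw [Mnum_succ h 0 hh, Mnum_one h hh]
    simp
    ring
  | succ n ih =>
    have hg : ∑ d ∈ range (2 * h + 1), d = (2 * h + 1) * h := by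
      have := sum_range_id_mul_two (2 * h + 1)
      rw [Nat.add_sub_cancel] at this
      linarith
    rw [Mnum_succ h (n + 1) hh, ih, if_pos (by omega), pow_succ, ← mul_assoc (2 * h),
      sum_range_mod, hg]
    ring

/-- the generating function of the `p^{(0)}`-Fibonacci numbers. -/
theorem p0_fibonacci_generating_function (p : ℕ) (hp : Nat.Prime p) (hodd : Odd p)
    (x : ℝ) (hx : |x| < 1 / p) :
    HasSum (fun n : ℕ => (Mnum p 0 (n + 2) 0 : ℝ) * x ^ n)
      (((p : ℝ) - 1) / 2 *
        ((2 * p - 2 * p * x) / (1 - p * x) ^ 2 - 1 / (1 - p * x))) := by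
  obtain ⟨h, rfl⟩ := hodd
  have hh : 1 ≤ h := by
    have := hp.two_le
    omega
  have hpos : (0 : ℝ) < ((2 * h + 1 : ℕ) : ℝ) := by positivity
  set q : ℝ := ((2 * h + 1 : ℕ) : ℝ) with hq
  have hr : ‖q * x‖ < 1 := by
    rw [Real.norm_eq_abs, abs_mul, abs_of_pos hpos, mul_comm]
    exact (lt_div_iff₀ hpos).1 hx
  have hne : 1 - q * x ≠ 0 := by
    have := (abs_lt.1 (Real.norm_eq_abs _ ▸ hr)).2
    linarith
  have hh_eq : (h : ℝ) = (q - 1) / 2 := by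
    rw [hq]
    push_cast
    ring
  have hsum := ((hasSum_geometric_of_norm_lt_one hr).mul_left ((q - 1) / 2 * (2 * q - 1))).add
    ((hasSum_coe_mul_geometric_of_norm_lt_one hr).mul_left ((q - 1) ^ 2))
  have hterm : (fun n : ℕ => (Mnum (2 * h + 1) 0 (n + 2) 0 : ℝ) * x ^ n) = fun n : ℕ =>
      (q - 1) / 2 * (2 * q - 1) * (q * x) ^ n + (q - 1) ^ 2 * (n * (q * x) ^ n) := by
    funext n
    rw [Mnum_eq h n hh, Nat.cast_mul, Nat.cast_mul, Nat.cast_pow, ← hq, Nat.cast_add, ← hq]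
    push_cast
    rw [hh_eq, mul_pow]
    ring
  have hval : (q - 1) / 2 * ((2 * q - 2 * q * x) / (1 - q * x) ^ 2 - 1 / (1 - q * x)) =
      (q - 1) / 2 * (2 * q - 1) * (1 - q * x)⁻¹ + (q - 1) ^ 2 * (q * x / (1 - q * x) ^ 2) := by
    field_simp
    ring
  rw [hterm, hval]
  exact hsum
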